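/- Let f : ℝ^d → ℝ^n be a linear map and let s ⊆ ℝ^d be a compact convex set. Then every extreme point of the image f(s) is the image under f of some extreme point of s; that is, extremePoints(f(s)) ⊆ f(extremePoints(s)). -/

import Mathlib

/-- For a linear map `f` and a compact convex set `s`, every
extreme point of the image `f '' s` is the image of an extreme point of `s`. -/
theorem extremePoints_image_subset
    (d n : ℕ)
    (f : EuclideanSpace ℝ (Fin d) →ₗ[ℝ] EuclideanSpace ℝ (Fin n))
    (s : Set (EuclideanSpace ℝ (Fin d)))
    (hcomp : IsCompact s) (hconv : Convex ℝ s) :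
    Set.extremePoints ℝ (f '' s) ⊆ f '' (Set.extremePoints ℝ s) :=
  surjOn_extremePoints_image f.toContinuousLinearMap.toContinuousAffineMap hcomp
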